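/- Let r ≥ 1 and s ∈ {-1, 1} be integers with Δ := r² + 4s > 0, and let (U_n)_{n≥0} be the generalized Lucas sequence with U_0 = 0, U_1 = 1, U_{n+1} = r·U_n + s·U_{n-1}; set δ := (r + √Δ)/2. Let b ≥ 2 be an integer and let k, m, n be positive integers and a an integer with 1 ≤ a ≤ b−1 satisfying a·(b^k − 1)/(b − 1) = U_n − U_m with n > m. Then |1 − δ^{−n}·b^k·(a√Δ)/((b − 1)(1 − δ^{m−n}))| < 8.1·√Δ/δ^n. -/

import Mathlib

/-- Binet's formula for the Lucas sequence attached to two roots `x`, `y` of `z² = r z + s`. -/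
theorem lucas_binet (r s : ℤ) (U : ℕ → ℤ) (hU0 : U 0 = 0) (hU1 : U 1 = 1)
    (hUrec : ∀ n : ℕ, U (n + 2) = r * U (n + 1) + s * U n) (x y : ℝ)
    (hx : x ^ 2 = r * x + s) (hy : y ^ 2 = r * y + s) (n : ℕ) :
    (x - y) * U n = x ^ n - y ^ n := by
  induction n using Nat.twoStepInduction with
  | zero => simp [hU0]
  | one => simp [hU1]
  | more n ih₀ ih₁ =>
    rw [hUrec]
    push_cast
    linear_combination (r : ℝ) * ih₁ + (s : ℝ) * ih₀ - x ^ n * hx + y ^ n * hy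


/-- `|1 − δ^{−n}·b^k·(a√Δ)/((b − 1)(1 − δ^{m−n}))| < 8.1·√Δ/δ^n`. -/
theorem repdigit_diff_lucas_linear_form_two
    (r s : ℤ) (hr : 1 ≤ r) (hs : s = -1 ∨ s = 1)
    (hΔ : (0 : ℤ) < r ^ 2 + 4 * s)
    (U : ℕ → ℤ) (hU0 : U 0 = 0) (hU1 : U 1 = 1)
    (hUrec : ∀ n : ℕ, U (n + 2) = r * U (n + 1) + s * U n)
    (δ : ℝ) (hδ : δ = ((r : ℝ) + Real.sqrt ((r : ℝ) ^ 2 + 4 * (s : ℝ))) / 2)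
    (b : ℤ) (hb : 2 ≤ b)
    (k m n : ℕ) (hk : 1 ≤ k) (hm : 1 ≤ m) (hn : 1 ≤ n) (hnm : m < n)
    (a : ℤ) (ha1 : 1 ≤ a) (ha2 : a ≤ b - 1)
    (heq : a * (b ^ k - 1) = (U n - U m) * (b - 1)) :
    |1 - δ ^ (-(n : ℤ)) * (b : ℝ) ^ k *
        ((a : ℝ) * Real.sqrt ((r : ℝ) ^ 2 + 4 * s) /
          (((b : ℝ) - 1) * (1 - δ ^ ((m : ℤ) - (n : ℤ)))))| <
      8.1 * Real.sqrt ((r : ℝ) ^ 2 + 4 * s) / δ ^ n := by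
  have hΔ5 : (5 : ℤ) ≤ r ^ 2 + 4 * s := by
    rcases hs with rfl | rfl
    · have : 3 ≤ r := by nlinarith
      nlinarith
    · nlinarith
  have hΔR : (5 : ℝ) ≤ (r : ℝ) ^ 2 + 4 * s := by exact_mod_cast hΔ5
  have hrR : (1 : ℝ) ≤ r := by exact_mod_cast hr
  set D := Real.sqrt ((r : ℝ) ^ 2 + 4 * s) with hD
  have hDsq : D ^ 2 = (r : ℝ) ^ 2 + 4 * s := Real.sq_sqrt (by linarith)
  have hD22 : 2.2 ≤ D := Real.le_sqrt_of_sq_le (by linarith)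
  have hδ16 : 1.6 ≤ δ := by linarith
  have hδ0 : 0 < δ := by linarith
  obtain ⟨γ, hγ⟩ : ∃ γ : ℝ, γ = ((r : ℝ) - D) / 2 := ⟨_, rfl⟩
  have hδsq : δ ^ 2 = r * δ + s := by
    rw [hδ]
    linear_combination hDsq / 4
  have hγsq : γ ^ 2 = r * γ + s := by
    rw [hγ]
    linear_combination hDsq / 4
  have hδγ : δ - γ = D := by
    rw [hδ, hγ]
    ring
  have hprod : δ * γ = -s := by
    rw [hδ, hγ]
    linear_combination -hDsq / 4
  have hγ1 : |γ| ≤ 1 := by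
    have h : δ * |γ| = 1 := by
      rw [← abs_of_pos hδ0, ← abs_mul, hprod]
      rcases hs with rfl | rfl <;> simp
    nlinarith [abs_nonneg γ]
  have hγpow (j : ℕ) : |γ ^ j| ≤ 1 := by
    rw [abs_pow]
    exact pow_le_one₀ (abs_nonneg γ) hγ1
  have binet := lucas_binet r s U hU0 hU1 hUrec δ γ hδsq hγsq
  rw [hδγ] at binet
  have hbR : (2 : ℝ) ≤ b := by exact_mod_cast hb
  have haR1 : (1 : ℝ) ≤ a := by exact_mod_cast ha1
  have haR2 : (a : ℝ) ≤ b - 1 := by exact_mod_cast ha2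
  have heqR : (a : ℝ) * ((b : ℝ) ^ k - 1) = ((U n : ℝ) - U m) * ((b : ℝ) - 1) := by
    exact_mod_cast heq
  have hb1 : (0 : ℝ) < (b : ℝ) - 1 := by linarith
  have hδn : 0 < δ ^ n := pow_pos hδ0 n
  have hδm : 0 < δ ^ m := pow_pos hδ0 m
  have hgap : 0.375 * δ ^ n ≤ δ ^ n - δ ^ m := by
    have h1 : δ ^ (m + 1) ≤ δ ^ n := pow_le_pow_right₀ (by linarith) hnm
    rw [pow_succ] at h1
    nlinarith
  have hE : 0 < δ ^ n - δ ^ m := by linarith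
  have hfrac0 : 0 ≤ (a : ℝ) / (b - 1) := by positivity
  have hfrac1 : (a : ℝ) / (b - 1) ≤ 1 := (div_le_one hb1).2 haR2
  have key : 1 - δ ^ (-(n : ℤ)) * (b : ℝ) ^ k *
      ((a : ℝ) * D / (((b : ℝ) - 1) * (1 - δ ^ ((m : ℤ) - (n : ℤ))))) =
      (γ ^ n - γ ^ m - a / (b - 1) * D) / (δ ^ n - δ ^ m) := by
    have h1 : 1 - δ ^ ((m : ℤ) - (n : ℤ)) = (δ ^ n - δ ^ m) / δ ^ n := by
      rw [zpow_sub₀ hδ0.ne', zpow_natCast, zpow_natCast]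
      field_simp
    rw [h1, zpow_neg, zpow_natCast]
    have hE' := hE.ne'
    have hb1' := hb1.ne'
    field_simp
    linear_combination -D * heqR - ((b : ℝ) - 1) * (binet n - binet m)
  rw [key, abs_div, abs_of_pos hE, div_lt_div_iff₀ hE hδn]
  have hnum : |γ ^ n - γ ^ m - a / (b - 1) * D| ≤ 2 * D := by
    have h1 := abs_le.1 (hγpow n)
    have h2 := abs_le.1 (hγpow m)
    have h3 : 0 ≤ (a : ℝ) / (b - 1) * D := by positivity
    have h4 : (a : ℝ) / (b - 1) * D ≤ D := mul_le_of_le_one_left (by linarith) hfrac1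
    rw [abs_le]
    constructor <;> linarith
  have hD0 : 0 < D := by linarith
  calc |γ ^ n - γ ^ m - a / (b - 1) * D| * δ ^ n ≤ 2 * D * δ ^ n := by gcongr
    _ < 8.1 * D * (0.375 * δ ^ n) := by nlinarith [mul_pos hD0 hδn]
    _ ≤ 8.1 * D * (δ ^ n - δ ^ m) := by gcongr
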